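/- (Theorem 4, first inequality) Let ρ be an N-partite density matrix with N ≥ 2. Then ∑_{i=1}^{N−1} Θ^{i|i+1⋯N}(ρ^{i⋯N}) + ∑_{i=1}^{N} C(ρ^i) ≤ C(ρ): the sum over i of the one-sided discords of the reduced states on subsystems i,…,N (with measurement on subsystem i), plus the sum of the relative entropies of coherence of the single-subsystem reduced states, is bounded above by the relative entropy of coherence of the total state. -/

import Mathlib

open Matrix
open Kronecker
open scoped ComplexOrder

/-- Von Neumann entropy of a matrix (defined via its eigenvalues when it is Hermitian). -/
noncomputable def vN {n : Type*} [Fintype n] [DecidableEq n] (ρ : Matrix n n ℂ) : ℝ :=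
  letI := Classical.propDecidable ρ.IsHermitian
  if h : ρ.IsHermitian then ∑ i, Real.negMulLog (h.eigenvalues i) else 0

/-- Full dephasing in the standard (product) basis. -/
noncomputable def deph {n : Type*} [Fintype n] [DecidableEq n] (ρ : Matrix n n ℂ) :
    Matrix n n ℂ := Matrix.diagonal fun i => ρ i i

/-- Relative entropy of coherence in the standard (product) basis. -/
noncomputable def coh {n : Type*} [Fintype n] [DecidableEq n] (ρ : Matrix n n ℂ) : ℝ :=
  vN (deph ρ) - vN ρ

/-- The tensor product `⊗U` of a family of local unitaries, as a matrix on the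
product index type. -/
noncomputable def locU {N : ℕ} {n : Fin N → Type*} [∀ i, Fintype (n i)]
    [∀ i, DecidableEq (n i)] (U : ∀ i, Matrix.unitaryGroup (n i) ℂ) :
    Matrix (∀ i, n i) (∀ i, n i) ℂ :=
  Matrix.of fun k k' => ∏ i, (U i : Matrix (n i) (n i) ℂ) (k i) (k' i)

/-- Reassemble a full multipartite index from its components strictly below `i`
(the "head"), at `i`, and strictly above `i` (the "tail"). -/
def glue {N : ℕ} {n : Fin N → Type*} (i : Fin N)
    (h : ∀ j : {j : Fin N // (j : ℕ) < (i : ℕ)}, n j)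
    (x : n i) (t : ∀ j : {j : Fin N // (i : ℕ) < (j : ℕ)}, n j) (j : Fin N) : n j :=
  if hj : (j : ℕ) < (i : ℕ) then h ⟨j, hj⟩
  else if hj' : (i : ℕ) < (j : ℕ) then t ⟨j, hj'⟩
  else (Fin.ext (le_antisymm (not_lt.mp hj) (not_lt.mp hj')) : i = j) ▸ x

/-- The reduced state of an `N`-partite state on subsystems `i, i+1, …, N`
(partial trace over the subsystems before `i`), regarded as a bipartite state
between subsystem `i` and subsystems `i+1, …, N`. -/
noncomputable def redTail {N : ℕ} {n : Fin N → Type*} [∀ i, Fintype (n i)]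
    [∀ i, DecidableEq (n i)] (ρ : Matrix (∀ i, n i) (∀ i, n i) ℂ) (i : Fin N) :
    Matrix (n i × ∀ j : {j : Fin N // (i : ℕ) < (j : ℕ)}, n j)
      (n i × ∀ j : {j : Fin N // (i : ℕ) < (j : ℕ)}, n j) ℂ :=
  Matrix.of fun p q => ∑ h : ∀ j : {j : Fin N // (j : ℕ) < (i : ℕ)}, n j,
    ρ (glue i h p.1 p.2) (glue i h q.1 q.2)

/-- The reduced density matrix of an `N`-partite state on subsystem `i`
(partial trace over all other subsystems). -/
noncomputable def red1 {N : ℕ} {n : Fin N → Type*} [∀ i, Fintype (n i)]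
    [∀ i, DecidableEq (n i)] (ρ : Matrix (∀ i, n i) (∀ i, n i) ℂ) (i : Fin N) :
    Matrix (n i) (n i) ℂ :=
  Matrix.of fun x x' => ∑ k : ∀ j : {j : Fin N // j ≠ i}, n j,
    ρ (fun j => if h : j = i then h.symm ▸ x else k ⟨j, h⟩)
      (fun j => if h : j = i then h.symm ▸ x' else k ⟨j, h⟩)

/-- Partial dephasing on the first factor of a bipartite state. -/
noncomputable def dephA {nA nB : Type*} [Fintype nA] [DecidableEq nA]
    [Fintype nB] [DecidableEq nB] (ρ : Matrix (nA × nB) (nA × nB) ℂ) :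
    Matrix (nA × nB) (nA × nB) ℂ :=
  Matrix.of fun p q => if p.1 = q.1 then ρ p q else 0

/-- Reduced state on the first factor of a bipartite state. -/
noncomputable def redA {nA nB : Type*} [Fintype nA] [DecidableEq nA]
    [Fintype nB] [DecidableEq nB] (ρ : Matrix (nA × nB) (nA × nB) ℂ) : Matrix nA nA ℂ :=
  Matrix.of fun a a' => ∑ b, ρ (a, b) (a', b)

/-- Reduced state on the second factor of a bipartite state. -/
noncomputable def redB {nA nB : Type*} [Fintype nA] [DecidableEq nA]
    [Fintype nB] [DecidableEq nB] (ρ : Matrix (nA × nB) (nA × nB) ℂ) : Matrix nB nB ℂ :=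
  Matrix.of fun b b' => ∑ a, ρ (a, b) (a, b')

/-- Quantum mutual information of a bipartite state. -/
noncomputable def mi {nA nB : Type*} [Fintype nA] [DecidableEq nA]
    [Fintype nB] [DecidableEq nB] (ρ : Matrix (nA × nB) (nA × nB) ℂ) : ℝ :=
  vN (redA ρ) + vN (redB ρ) - vN ρ

/-- The action `(U ⊗ 1) ρ (U ⊗ 1)∗` of a local unitary on the first factor. -/
noncomputable def conjA {nA nB : Type*} [Fintype nA] [DecidableEq nA]
    [Fintype nB] [DecidableEq nB] (U : Matrix nA nA ℂ)
    (ρ : Matrix (nA × nB) (nA × nB) ℂ) : Matrix (nA × nB) (nA × nB) ℂ :=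
  (U ⊗ₖ (1 : Matrix nB nB ℂ)) * ρ * (U ⊗ₖ (1 : Matrix nB nB ℂ))ᴴ



lemma log_pinching_le {ι κ m : Type*} [Fintype ι] [Fintype κ] [Fintype m]
    (w : ι → κ → ℝ) (l : ι → ℝ) (μ : κ → ℝ) (p q : m → ℝ)
    (hw1 : ∀ i, ∑ j, w i j = 1)
    (hl : ∀ i, 0 ≤ l i) (hμ : ∀ j, 0 ≤ μ j) (hp : ∀ k, 0 ≤ p k) (hq : ∀ k, 0 ≤ q k)
    (hsum : ∑ i, l i = ∑ k, p k)
    (hwμ : ∀ i j, μ j = 0 → w i j * l i = 0) (hpq : ∀ k, q k = 0 → p k = 0)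
    (hle : ∀ t : ℝ, 0 < t → ∑ k, p k ^ 2 / (t * p k + q k)
      ≤ ∑ i, ∑ j, w i j * l i ^ 2 / (t * l i + μ j)) :
    ∑ k, p k * (Real.log (p k) - Real.log (q k))
      ≤ ∑ i, ∑ j, w i j * l i * (Real.log (l i) - Real.log (μ j)) := by
  set F : ℝ → ℝ := fun t => ∑ i, ∑ j, w i j * l i * (Real.log (t * l i + μ j) - Real.log (μ j))
    - ∑ k, p k * (Real.log (t * p k + q k) - Real.log (q k)) with hF
  have hderiv1 : ∀ c a b t : ℝ, 0 ≤ t → 0 ≤ a → 0 ≤ b → (b = 0 → c * a = 0) →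
      HasDerivAt (fun t => c * a * (Real.log (t * a + b) - Real.log b))
        (c * a ^ 2 / (t * a + b)) t := by
    intro c a b t ht ha hb h
    by_cases hb0 : b = 0
    · have h0 := h hb0
      have : c * a ^ 2 = 0 := by rw [pow_two, ← mul_assoc, h0, zero_mul]
      simp only [h0, zero_mul, this, zero_div]
      exact hasDerivAt_const _ _
    · have hpos : 0 < t * a + b := by positivity
      have h1 : HasDerivAt (fun t : ℝ => t * a + b) a t := by
        simpa using ((hasDerivAt_id t).mul_const a).add_const b
      have := ((h1.log hpos.ne').sub_const (Real.log b)).const_mul (c * a)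
      exact this.congr_deriv (by ring)
  have hderiv : ∀ t : ℝ, 0 ≤ t → HasDerivAt F
      (∑ i, ∑ j, w i j * l i ^ 2 / (t * l i + μ j) - ∑ k, p k ^ 2 / (t * p k + q k)) t := by
    intro t ht
    refine HasDerivAt.sub ?_ ?_
    · refine HasDerivAt.fun_sum fun i _ => HasDerivAt.fun_sum fun j _ => ?_
      exact hderiv1 _ _ _ _ ht (hl i) (hμ j) (hwμ i j)
    · refine HasDerivAt.fun_sum fun k _ => ?_
      simpa using hderiv1 1 _ _ _ ht (hp k) (hq k) (by simpa using hpq k)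
  have hmono : MonotoneOn F (Set.Ici 0) := by
    refine monotoneOn_of_deriv_nonneg (convex_Ici 0)
      (fun t ht => (hderiv t ht).continuousAt.continuousWithinAt) ?_ ?_
    · intro t ht
      exact (hderiv t (interior_subset ht)).differentiableAt.differentiableWithinAt
    · intro t ht
      rw [(hderiv t (interior_subset ht)).deriv]
      rw [interior_Ici] at ht
      linarith [hle t ht]
  have hF0 : F 0 = 0 := by simp [hF]
  have hFnn : ∀ t : ℝ, 0 < t → 0 ≤ F t := fun t ht =>
    hF0 ▸ hmono (Set.self_mem_Ici) ht.le ht.le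
  have hlim1 : ∀ c a b : ℝ, 0 ≤ a → 0 ≤ b →
      Filter.Tendsto (fun t => c * a * (Real.log (t * a + b) - Real.log b) - c * a * Real.log t)
        Filter.atTop (nhds (c * a * (Real.log a - Real.log b))) := by
    intro c a b ha hb
    rcases ha.eq_or_lt with rfl | ha
    · simp
    · have h1 : Filter.Tendsto (fun t : ℝ => a + b * t⁻¹) Filter.atTop (nhds a) := by
        simpa using tendsto_const_nhds.add (tendsto_inv_atTop_zero.const_mul b)
      have h2 := ((h1.log ha.ne').sub_const (Real.log b)).const_mul (c * a)
      refine h2.congr' ?_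
      filter_upwards [Filter.eventually_gt_atTop 0] with t ht
      have : t * a + b = t * (a + b * t⁻¹) := by field_simp
      rw [this, Real.log_mul ht.ne' (by positivity)]
      ring
  have hlim : Filter.Tendsto F Filter.atTop
      (nhds (∑ i, ∑ j, w i j * l i * (Real.log (l i) - Real.log (μ j))
        - ∑ k, p k * (Real.log (p k) - Real.log (q k)))) := by
    have h1 := tendsto_finsetSum Finset.univ fun i _ =>
      tendsto_finsetSum Finset.univ fun j _ => hlim1 (w i j) (l i) (μ j) (hl i) (hμ j)
    have h2 := tendsto_finsetSum Finset.univ fun k _ => hlim1 1 (p k) (q k) (hp k) (hq k)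
    simp only [one_mul] at h2
    refine (h1.sub h2).congr fun t => ?_
    have h3 : ∑ i, ∑ j, w i j * l i * Real.log t = ∑ k, p k * Real.log t := by
      rw [← Finset.sum_mul, ← hsum, Finset.sum_mul]
      refine Finset.sum_congr rfl fun i _ => ?_
      rw [← Finset.sum_mul, ← Finset.sum_mul, hw1, one_mul]
    simp only [Finset.sum_sub_distrib, h3, hF]
    ring
  have := ge_of_tendsto hlim ((Filter.eventually_gt_atTop 0).mono hFnn)
  linarith

lemma two_mul_re_le_weighted {z m : ℂ} {l μ t : ℝ} (hl : 0 ≤ l) (hμ : 0 ≤ μ) (ht : 0 < t) :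
    2 * l * (z * star m).re ≤ (t * l + μ) * Complex.normSq z
      + Complex.normSq m * l ^ 2 / (t * l + μ) := by
  rcases hl.eq_or_lt with rfl | hl
  · simpa using mul_nonneg hμ (Complex.normSq_nonneg z)
  · have hs : 0 < t * l + μ := by positivity
    have h : 0 ≤ ((t * l + μ) * z.re - l * m.re) ^ 2 / (t * l + μ)
        + ((t * l + μ) * z.im - l * m.im) ^ 2 / (t * l + μ) := by positivity
    have e : ((t * l + μ) * z.re - l * m.re) ^ 2 / (t * l + μ)
        + ((t * l + μ) * z.im - l * m.im) ^ 2 / (t * l + μ)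
        = (t * l + μ) * Complex.normSq z
          + Complex.normSq m * l ^ 2 / (t * l + μ) - 2 * l * (z * star m).re := by
      simp only [Complex.normSq_apply, Complex.star_def, Complex.mul_re, Complex.conj_re,
        Complex.conj_im]
      field_simp
      ring
    linarith

lemma sum_normSq_row {m n : Type*} [Fintype m] [Fintype n] (A : Matrix m n ℂ) (i : m) :
    ((∑ j, Complex.normSq (A i j) : ℝ) : ℂ) = (A * Aᴴ) i i := by
  simp [Matrix.mul_apply, Complex.mul_conj]

lemma sum_normSq_col {m n : Type*} [Fintype m] [Fintype n] (A : Matrix m n ℂ) (j : n) :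
    ((∑ i, Complex.normSq (A i j) : ℝ) : ℂ) = (Aᴴ * A) j j := by
  simp [Matrix.mul_apply, Complex.normSq_eq_conj_mul_self]

lemma sum_normSq_row_mul {l m : Type*} [Fintype l] [Fintype m] [DecidableEq m]
    (A : Matrix l m ℂ) {W : Matrix m m ℂ} (hW : W * Wᴴ = 1) (i : l) :
    ∑ j, Complex.normSq ((A * W) i j) = ∑ k, Complex.normSq (A i k) := by
  apply Complex.ofReal_injective
  rw [sum_normSq_row, sum_normSq_row, conjTranspose_mul, Matrix.mul_assoc, ← Matrix.mul_assoc W, hW,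
    Matrix.one_mul]

lemma sum_normSq_col_mul {l m : Type*} [Fintype l] [Fintype m] [DecidableEq m]
    (B : Matrix m l ℂ) {V : Matrix m m ℂ} (hV : V * Vᴴ = 1) (j : l) :
    ∑ i, Complex.normSq ((Vᴴ * B) i j) = ∑ k, Complex.normSq (B k j) := by
  apply Complex.ofReal_injective
  rw [sum_normSq_col, sum_normSq_col, conjTranspose_mul, conjTranspose_conjTranspose,
    Matrix.mul_assoc, ← Matrix.mul_assoc V, hV, Matrix.one_mul]

lemma sum_sq_div_le_of_unitary {m : Type*} [Fintype m] [DecidableEq m]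
    {V W : Matrix m m ℂ} (hV : V * Vᴴ = 1) (hW : W * Wᴴ = 1) {l μ p q : m → ℝ}
    (hl : ∀ i, 0 ≤ l i) (hμ : ∀ j, 0 ≤ μ j)
    (hp : ∀ k, p k = ∑ i, l i * Complex.normSq (V k i))
    (hq : ∀ k, q k = ∑ j, μ j * Complex.normSq (W k j)) {t : ℝ} (ht : 0 < t) :
    ∑ k, p k ^ 2 / (t * p k + q k)
      ≤ ∑ i, ∑ j, Complex.normSq ((Vᴴ * W) i j) * l i ^ 2 / (t * l i + μ j) := by
  set x : m → ℝ := fun k => p k / (t * p k + q k) with hx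
  set D : Matrix m m ℂ := diagonal fun k => (x k : ℂ) with hD
  set X : Matrix m m ℂ := Vᴴ * (D * W) with hX
  have hrow : ∀ i, ∑ j, Complex.normSq (X i j) = ∑ k, x k ^ 2 * Complex.normSq (V k i) := by
    intro i
    rw [hX, ← Matrix.mul_assoc, sum_normSq_row_mul _ hW]
    refine Finset.sum_congr rfl fun k _ => ?_
    rw [hD, mul_diagonal, conjTranspose_apply, Complex.normSq_mul, Complex.normSq_ofReal,
      Complex.star_def, Complex.normSq_conj]
    ring
  have hcol : ∀ j, ∑ i, Complex.normSq (X i j) = ∑ k, x k ^ 2 * Complex.normSq (W k j) := by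
    intro j
    rw [hX, sum_normSq_col_mul _ hV]
    refine Finset.sum_congr rfl fun k _ => ?_
    rw [hD, diagonal_mul, Complex.normSq_mul, Complex.normSq_ofReal]
    ring
  have hcross : ∀ i, ∑ j, (X i j * star ((Vᴴ * W) i j)).re
      = ∑ k, x k * Complex.normSq (V k i) := by
    intro i
    have h1 : ∑ j, X i j * star ((Vᴴ * W) i j) = (X * (Vᴴ * W)ᴴ) i i := by
      rw [Matrix.mul_apply]
      simp only [conjTranspose_apply]
    have h2 : X * (Vᴴ * W)ᴴ = Vᴴ * (D * V) := by
      rw [hX, conjTranspose_mul, conjTranspose_conjTranspose, Matrix.mul_assoc, Matrix.mul_assoc,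
        ← Matrix.mul_assoc W, hW, Matrix.one_mul]
    rw [← Complex.re_sum, h1, h2, Matrix.mul_apply, Complex.re_sum]
    refine Finset.sum_congr rfl fun k _ => ?_
    rw [hD, diagonal_mul, conjTranspose_apply, Complex.star_def, mul_left_comm,
      ← Complex.normSq_eq_conj_mul_self, Complex.re_ofReal_mul, Complex.ofReal_re]
  have hsum := Finset.sum_le_sum fun i (_ : i ∈ Finset.univ) =>
    Finset.sum_le_sum fun j (_ : j ∈ Finset.univ) =>
      two_mul_re_le_weighted (z := X i j) (m := (Vᴴ * W) i j) (hl i) (hμ j) ht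
  have e1 : ∑ i, ∑ j, 2 * l i * (X i j * star ((Vᴴ * W) i j)).re = ∑ k, 2 * (x k * p k) := by
    simp_rw [← Finset.mul_sum, hcross, hp, Finset.mul_sum]
    rw [Finset.sum_comm]
    refine Finset.sum_congr rfl fun k _ => Finset.sum_congr rfl fun i _ => by ring
  have e2 : ∑ i, ∑ j, (t * l i + μ j) * Complex.normSq (X i j)
      = ∑ k, x k ^ 2 * (t * p k + q k) := by
    have h1 : ∑ i, ∑ j, t * l i * Complex.normSq (X i j) = ∑ k, x k ^ 2 * (t * p k) := by
      simp_rw [← Finset.mul_sum, hrow, hp, Finset.mul_sum]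
      rw [Finset.sum_comm]
      refine Finset.sum_congr rfl fun k _ => Finset.sum_congr rfl fun i _ => by ring
    have h2 : ∑ i, ∑ j, μ j * Complex.normSq (X i j) = ∑ k, x k ^ 2 * q k := by
      rw [Finset.sum_comm]
      simp_rw [← Finset.mul_sum, hcol, hq, Finset.mul_sum]
      rw [Finset.sum_comm]
      refine Finset.sum_congr rfl fun k _ => Finset.sum_congr rfl fun i _ => by ring
    simp only [add_mul, mul_add, Finset.sum_add_distrib, h1, h2]
  have e3 : ∑ k, 2 * (x k * p k) - ∑ k, x k ^ 2 * (t * p k + q k)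
      = ∑ k, p k ^ 2 / (t * p k + q k) := by
    rw [← Finset.sum_sub_distrib]
    refine Finset.sum_congr rfl fun k _ => ?_
    by_cases h : t * p k + q k = 0
    · simp [hx, h]
    · simp only [hx]
      field_simp
      ring
  simp only [Finset.sum_add_distrib] at hsum
  rw [e1, e2] at hsum
  linarith

/-- Monotonicity of the relative entropy under measurement in the standard basis, for two positive
matrices given by their spectral decompositions. -/
lemma log_pinching_le_of_unitary {m : Type*} [Fintype m] [DecidableEq m]
    {V W : Matrix m m ℂ} (hV : V * Vᴴ = 1) (hW : W * Wᴴ = 1) {l μ p q : m → ℝ}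
    (hl : ∀ i, 0 ≤ l i) (hμ : ∀ j, 0 ≤ μ j)
    (hp : ∀ k, p k = ∑ i, l i * Complex.normSq (V k i))
    (hq : ∀ k, q k = ∑ j, μ j * Complex.normSq (W k j))
    (hwμ : ∀ j, μ j = 0 → ∑ i, Complex.normSq ((Vᴴ * W) i j) * l i = 0)
    (hpq : ∀ k, q k = 0 → p k = 0) :
    ∑ k, p k * (Real.log (p k) - Real.log (q k))
      ≤ ∑ i, l i * Real.log (l i)
        - ∑ j, (∑ i, Complex.normSq ((Vᴴ * W) i j) * l i) * Real.log (μ j) := by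
  have hVl : Vᴴ * V = 1 := mul_eq_one_comm.mp hV
  have hw1 : ∀ i, ∑ j, Complex.normSq ((Vᴴ * W) i j) = 1 := fun i => by
    rw [sum_normSq_row_mul _ hW]
    apply Complex.ofReal_injective
    rw [sum_normSq_row, conjTranspose_conjTranspose, hVl]
    simp
  refine (log_pinching_le (fun i j => Complex.normSq ((Vᴴ * W) i j)) l μ p q
    hw1 hl hμ (fun k => ?_) (fun k => ?_) ?_ (fun i j h => ?_)
    hpq fun t ht => sum_sq_div_le_of_unitary hV hW hl hμ hp hq ht).trans_eq ?_
  · rw [hp]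
    exact Finset.sum_nonneg fun i _ => mul_nonneg (hl i) (Complex.normSq_nonneg _)
  · rw [hq]
    exact Finset.sum_nonneg fun i _ => mul_nonneg (hμ i) (Complex.normSq_nonneg _)
  · simp_rw [hp]
    rw [Finset.sum_comm]
    refine Finset.sum_congr rfl fun i _ => ?_
    have : ∑ k, Complex.normSq (V k i) = 1 := by
      apply Complex.ofReal_injective
      rw [sum_normSq_col, hVl]
      simp
    rw [← Finset.mul_sum, this, mul_one]
  · exact (Finset.sum_eq_zero_iff_of_nonneg fun i _ =>
      mul_nonneg (Complex.normSq_nonneg _) (hl i)).mp (hwμ j h) i (Finset.mem_univ i)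
  · simp_rw [mul_sub, Finset.sum_sub_distrib, Finset.sum_mul]
    congr 1
    · refine Finset.sum_congr rfl fun i _ => ?_
      rw [← Finset.sum_mul, ← Finset.sum_mul, hw1, one_mul]
    · exact Finset.sum_comm

lemma mul_diagonal_mul_conjTranspose_apply_self {n m : Type*} [Fintype n] [DecidableEq n]
    (A : Matrix m n ℂ) (d : n → ℝ) (k : m) :
    (A * diagonal (fun i => (d i : ℂ)) * Aᴴ) k k
      = ((∑ i, d i * Complex.normSq (A k i) : ℝ) : ℂ) := by
  rw [Matrix.mul_apply, Complex.ofReal_sum]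
  refine Finset.sum_congr rfl fun i _ => ?_
  rw [mul_diagonal, conjTranspose_apply, Complex.star_def, mul_right_comm, Complex.mul_conj,
    Complex.ofReal_mul, mul_comm]

section Entropy

variable {n m : Type*} [Fintype n] [DecidableEq n] [Fintype m] [DecidableEq m]

lemma vN_of_isHermitian {ρ : Matrix n n ℂ} (h : ρ.IsHermitian) :
    vN ρ = ∑ i, Real.negMulLog (h.eigenvalues i) := by
  simp [vN, h]

lemma vN_eq_sum_roots {ρ : Matrix n n ℂ} (h : ρ.IsHermitian) :
    vN ρ = (ρ.charpoly.roots.map fun z => Real.negMulLog z.re).sum := by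
  rw [vN_of_isHermitian h, h.roots_charpoly_eq_eigenvalues, Multiset.map_map]
  rfl

lemma vN_submatrix_equiv (ρ : Matrix n n ℂ) (e : m ≃ n) : vN (ρ.submatrix e e) = vN ρ := by
  by_cases h : ρ.IsHermitian
  · rw [vN_eq_sum_roots h, vN_eq_sum_roots (h.submatrix e), ← charpoly_reindex e.symm ρ]
    rfl
  · have h' : ¬ (ρ.submatrix e e).IsHermitian := fun h' => h (by
      simpa using h'.submatrix e.symm)
    simp [vN, h, h']

lemma vN_diagonal (d : n → ℝ) :
    vN (diagonal fun i => (d i : ℂ)) = ∑ i, Real.negMulLog (d i) := by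
  have h : (diagonal fun i => (d i : ℂ)).IsHermitian := by
    simp [IsHermitian, diagonal_conjTranspose, Pi.star_def]
  rw [vN_eq_sum_roots h, charpoly_diagonal, Polynomial.roots_prod]
  · simp
  · simp [Finset.prod_ne_zero_iff, Polynomial.X_sub_C_ne_zero]

lemma vN_deph {ρ : Matrix n n ℂ} (h : ρ.IsHermitian) :
    vN (deph ρ) = ∑ i, Real.negMulLog (ρ i i).re := by
  rw [← vN_diagonal]
  have : deph ρ = diagonal fun i => ((ρ i i).re : ℂ) :=
    congrArg diagonal (funext fun i => (h.coe_re_apply_self i).symm)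
  rw [this]

lemma coh_submatrix_equiv (ρ : Matrix n n ℂ) (e : m ≃ n) :
    coh (ρ.submatrix e e) = coh ρ := by
  have : deph (ρ.submatrix e e) = (deph ρ).submatrix e e := by
    simp only [deph, submatrix_diagonal_equiv]
    rfl
  rw [coh, coh, this, vN_submatrix_equiv, vN_submatrix_equiv]

lemma coh_of_subsingleton [Subsingleton n] (ρ : Matrix n n ℂ) : coh ρ = 0 := by
  have : deph ρ = ρ := by
    ext i j
    obtain rfl := Subsingleton.elim i j
    simp [deph]
  rw [coh, this, sub_self]

lemma vN_nonneg {ρ : Matrix n n ℂ} (h : ρ.PosSemidef) (htr : ρ.trace = 1) : 0 ≤ vN ρ := by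
  have hsum : ∑ i, h.1.eigenvalues i = 1 := by
    apply Complex.ofReal_injective
    have := h.1.trace_eq_sum_eigenvalues
    rw [htr] at this
    simpa using this.symm
  rw [vN_of_isHermitian h.1]
  refine Finset.sum_nonneg fun i _ => Real.negMulLog_nonneg (h.eigenvalues_nonneg i) ?_
  rw [← hsum]
  exact Finset.single_le_sum (fun j _ => h.eigenvalues_nonneg j) (Finset.mem_univ i)

lemma vN_le_card {ρ : Matrix n n ℂ} (h : ρ.PosSemidef) : vN ρ ≤ Fintype.card n := by
  rw [vN_of_isHermitian h.1]
  refine (Finset.sum_le_card_nsmul _ _ 1 fun i _ => ?_).trans (by simp)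
  have h0 := h.eigenvalues_nonneg i
  have := Real.negMulLog_le_one_sub_self h0
  linarith

lemma Matrix.IsHermitian.eq_mul_diagonal_mul {ρ : Matrix n n ℂ} (h : ρ.IsHermitian) :
    ρ = (h.eigenvectorUnitary : Matrix n n ℂ) * diagonal (fun i => (h.eigenvalues i : ℂ))
      * (h.eigenvectorUnitary : Matrix n n ℂ)ᴴ := by
  conv_lhs => rw [h.spectral_theorem, Unitary.conjStarAlgAut_apply]
  rfl

end Entropy

section Bipartite

variable {nA nB : Type*} [Fintype nA] [DecidableEq nA] [Fintype nB] [DecidableEq nB]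

lemma Matrix.PosSemidef.redA {ρ : Matrix (nA × nB) (nA × nB) ℂ} (h : ρ.PosSemidef) :
    (redA ρ).PosSemidef := by
  have : _root_.redA ρ = ∑ b, ρ.submatrix (fun a => (a, b)) (fun a => (a, b)) := by
    ext a a'
    simp [_root_.redA, Matrix.sum_apply]
  rw [this]
  exact posSemidef_sum _ fun b _ => h.submatrix _

lemma Matrix.PosSemidef.redB {ρ : Matrix (nA × nB) (nA × nB) ℂ} (h : ρ.PosSemidef) :
    (redB ρ).PosSemidef := by
  have : _root_.redB ρ = ∑ a, ρ.submatrix (fun b => (a, b)) (fun b => (a, b)) := by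
    ext b b'
    simp [_root_.redB, Matrix.sum_apply]
  rw [this]
  exact posSemidef_sum _ fun a _ => h.submatrix _

lemma Matrix.PosSemidef.dephA {ρ : Matrix (nA × nB) (nA × nB) ℂ} (h : ρ.PosSemidef) :
    (dephA ρ).PosSemidef := by
  have : _root_.dephA ρ = ∑ a, diagonal (fun p : nA × nB => if p.1 = a then (1 : ℂ) else 0) * ρ
      * (diagonal (fun p : nA × nB => if p.1 = a then (1 : ℂ) else 0))ᴴ := by
    ext p q
    simp only [_root_.dephA, of_apply, Matrix.sum_apply, diagonal_conjTranspose, mul_diagonal,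
      diagonal_mul, Pi.star_apply]
    rw [Finset.sum_eq_single p.1 (fun b _ hb => by simp [hb.symm]) (by simp)]
    by_cases h : p.1 = q.1 <;> simp [h, eq_comm]
  rw [this]
  exact posSemidef_sum _ fun a _ => h.mul_mul_conjTranspose_same _

lemma Matrix.PosSemidef.conjA {ρ : Matrix (nA × nB) (nA × nB) ℂ} (h : ρ.PosSemidef)
    (U : Matrix nA nA ℂ) : (conjA U ρ).PosSemidef :=
  h.mul_mul_conjTranspose_same _

lemma trace_dephA (ρ : Matrix (nA × nB) (nA × nB) ℂ) : (dephA ρ).trace = ρ.trace := by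
  simp [Matrix.trace, dephA]

lemma trace_conjA (U : Matrix.unitaryGroup nA ℂ) (ρ : Matrix (nA × nB) (nA × nB) ℂ) :
    (conjA (U : Matrix nA nA ℂ) ρ).trace = ρ.trace := by
  have h : (U : Matrix nA nA ℂ)ᴴ * (U : Matrix nA nA ℂ) = 1 :=
    mem_unitaryGroup_iff'.mp U.2
  rw [conjA, Matrix.trace_mul_cycle, conjTranspose_kronecker, ← mul_kronecker_mul, h]
  simp

lemma conjA_one (ρ : Matrix (nA × nB) (nA × nB) ℂ) : conjA 1 ρ = ρ := by
  simp [conjA]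

lemma redA_dephA (ρ : Matrix (nA × nB) (nA × nB) ℂ) : redA (dephA ρ) = deph (redA ρ) := by
  ext a a'
  by_cases h : a = a' <;> simp [redA, dephA, deph, h]

lemma redB_dephA (ρ : Matrix (nA × nB) (nA × nB) ℂ) : redB (dephA ρ) = redB ρ := by
  ext b b'
  simp [redB, dephA]

lemma deph_dephA (ρ : Matrix (nA × nB) (nA × nB) ℂ) : deph (dephA ρ) = deph ρ := by
  simp [deph, dephA]

lemma redB_one_kronecker_conj (ρ : Matrix (nA × nB) (nA × nB) ℂ) (W : Matrix nB nB ℂ) :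
    redB (((1 : Matrix nA nA ℂ) ⊗ₖ W)ᴴ * ρ * ((1 : Matrix nA nA ℂ) ⊗ₖ W))
      = Wᴴ * redB ρ * W := by
  ext b b'
  simp only [redB, of_apply, Matrix.mul_apply, conjTranspose_apply, kroneckerMap_apply,
    one_apply, Fintype.sum_prod_type, ite_mul, one_mul, zero_mul, apply_ite (star : ℂ → ℂ),
    star_zero, Finset.sum_ite_eq', Finset.mem_univ, if_true, mul_ite, mul_zero,
    Finset.mul_sum, Finset.sum_mul, Finset.sum_ite_irrel, Finset.sum_const_zero]
  rw [Finset.sum_comm]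
  refine Finset.sum_congr rfl fun d _ => ?_
  rw [Finset.sum_comm]

/-- Discarding the first factor does not increase the relative entropy of coherence. -/
lemma coh_redB_le {ρ : Matrix (nA × nB) (nA × nB) ℂ} (h : ρ.PosSemidef) :
    coh (redB ρ) ≤ coh ρ := by
  have hB := h.redB
  set V : Matrix (nA × nB) (nA × nB) ℂ := h.1.eigenvectorUnitary.1
  set WB : Matrix nB nB ℂ := hB.1.eigenvectorUnitary.1
  set W : Matrix (nA × nB) (nA × nB) ℂ := (1 : Matrix nA nA ℂ) ⊗ₖ WB with hWdef
  set l := h.1.eigenvalues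
  set μ := hB.1.eigenvalues
  have hV : V * Vᴴ = 1 := mem_unitaryGroup_iff.mp h.1.eigenvectorUnitary.2
  have hWB : WB * WBᴴ = 1 := mem_unitaryGroup_iff.mp hB.1.eigenvectorUnitary.2
  have hWB' : WBᴴ * WB = 1 := mem_unitaryGroup_iff'.mp hB.1.eigenvectorUnitary.2
  have hW : W * Wᴴ = 1 := by
    rw [hWdef, conjTranspose_kronecker, ← mul_kronecker_mul, hWB]
    simp
  have hρ : ρ = V * diagonal (fun i => (l i : ℂ)) * Vᴴ := h.1.eq_mul_diagonal_mul
  have hρB : redB ρ = WB * diagonal (fun i => (μ i : ℂ)) * WBᴴ := hB.1.eq_mul_diagonal_mul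
  have hr : ∀ j, ((∑ i, Complex.normSq ((Vᴴ * W) i j) * l i : ℝ) : ℂ) = (Wᴴ * ρ * W) j j := by
    intro j
    have : Wᴴ * ρ * W = (Wᴴ * V) * diagonal (fun i => (l i : ℂ)) * (Wᴴ * V)ᴴ := by
      rw [hρ, conjTranspose_mul, conjTranspose_conjTranspose]
      simp only [Matrix.mul_assoc]
    rw [this, mul_diagonal_mul_conjTranspose_apply_self]
    congr 1
    refine Finset.sum_congr rfl fun i _ => ?_
    have : (Wᴴ * V) j i = star ((Vᴴ * W) i j) := by
      rw [← conjTranspose_apply, conjTranspose_mul, conjTranspose_conjTranspose]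
    rw [this, Complex.star_def, Complex.normSq_conj, mul_comm]
  have hrnn : ∀ j, 0 ≤ ∑ i, Complex.normSq ((Vᴴ * W) i j) * l i := fun j =>
    Finset.sum_nonneg fun i _ => mul_nonneg (Complex.normSq_nonneg _) (h.eigenvalues_nonneg i)
  have hrsum : ∀ b, ∑ a, ∑ i, Complex.normSq ((Vᴴ * W) i (a, b)) * l i = μ b := by
    intro b
    apply Complex.ofReal_injective
    rw [Complex.ofReal_sum]
    simp_rw [hr]
    have h1 : ∑ a, (Wᴴ * ρ * W) (a, b) (a, b) = redB (Wᴴ * ρ * W) b b := rfl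
    rw [h1, redB_one_kronecker_conj, hρB]
    have : WBᴴ * (WB * diagonal (fun i => (μ i : ℂ)) * WBᴴ) * WB
        = (WBᴴ * WB) * diagonal (fun i => (μ i : ℂ)) * (WBᴴ * WB) := by
      simp only [Matrix.mul_assoc]
    rw [this, hWB', Matrix.one_mul, Matrix.mul_one, diagonal_apply_eq]
  have hpsum : ∀ b, ∑ a, (ρ (a, b) (a, b)).re = (redB ρ b b).re := fun b => by
    simp [redB]
  have hpnn : ∀ k, 0 ≤ (ρ k k).re := fun k => (Complex.nonneg_iff.mp h.diag_nonneg).1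
  have key := log_pinching_le_of_unitary hV hW (l := l) (μ := fun j => μ j.2)
    (p := fun k => (ρ k k).re) (q := fun k => (redB ρ k.2 k.2).re)
    h.eigenvalues_nonneg (fun j => hB.eigenvalues_nonneg j.2)
    (fun k => by
      conv_lhs => rw [hρ]
      rw [mul_diagonal_mul_conjTranspose_apply_self, Complex.ofReal_re])
    (fun k => by
      conv_lhs => rw [hρB]
      rw [mul_diagonal_mul_conjTranspose_apply_self, Complex.ofReal_re, Fintype.sum_prod_type,
        Finset.sum_eq_single k.1]
      · simp [hWdef]
      · intro a _ ha
        simp [hWdef, one_apply, ha.symm]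
      · simp)
    (fun j hj => by
      have := hrsum j.2
      rw [hj, Finset.sum_eq_zero_iff_of_nonneg fun a _ => hrnn _] at this
      exact this j.1 (Finset.mem_univ _))
    (fun k hk => by
      have := hpsum k.2
      rw [hk, Finset.sum_eq_zero_iff_of_nonneg fun a _ => hpnn _] at this
      exact this k.1 (Finset.mem_univ _))
  have e1 : ∑ j : nA × nB, (∑ i, Complex.normSq ((Vᴴ * W) i j) * l i) * Real.log (μ j.2)
      = ∑ b, μ b * Real.log (μ b) := by
    rw [Fintype.sum_prod_type_right]
    refine Finset.sum_congr rfl fun b _ => ?_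
    simp only [← Finset.sum_mul, hrsum]
  have e2 : ∑ k : nA × nB, (ρ k k).re * Real.log (redB ρ k.2 k.2).re
      = ∑ b, (redB ρ b b).re * Real.log (redB ρ b b).re := by
    rw [Fintype.sum_prod_type_right]
    refine Finset.sum_congr rfl fun b _ => ?_
    simp only [← Finset.sum_mul, hpsum]
  simp only [mul_sub, Finset.sum_sub_distrib] at key
  rw [e1, e2] at key
  rw [coh, coh, vN_deph h.1, vN_deph hB.1, vN_of_isHermitian h.1, vN_of_isHermitian hB.1]
  simp only [Real.negMulLog, neg_mul, Finset.sum_neg_distrib]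
  linarith

lemma coh_redA_of_subsingleton [Subsingleton nB] [Nonempty nB]
    (ρ : Matrix (nA × nB) (nA × nB) ℂ) : coh (redA ρ) = coh ρ := by
  let _ : Unique nB := Classical.choice (nonempty_unique nB)
  rw [← coh_submatrix_equiv ρ (Equiv.prodUnique nA nB).symm]
  congr 1
  ext a a'
  simp [redA]

/-- The discord is at most the coherence lost by measuring in the standard basis. -/
lemma iInf_mi_sub_mi_add_coh_le {ρ : Matrix (nA × nB) (nA × nB) ℂ} (h : ρ.PosSemidef)
    (htr : ρ.trace = 1) :
    (⨅ U : Matrix.unitaryGroup nA ℂ,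
        (mi ρ - mi (dephA (conjA (U : Matrix nA nA ℂ) ρ)))) + coh (redA ρ)
      ≤ coh ρ - coh (redB ρ) := by
  have hbdd : BddBelow (Set.range fun U : Matrix.unitaryGroup nA ℂ =>
      mi ρ - mi (dephA (conjA (U : Matrix nA nA ℂ) ρ))) := by
    refine ⟨mi ρ - (Fintype.card nA + Fintype.card nB), ?_⟩
    rintro _ ⟨U, rfl⟩
    have hU := (h.conjA (U : Matrix nA nA ℂ)).dephA
    have h1 := vN_nonneg hU (by rw [trace_dephA, trace_conjA, htr])
    have h2 := vN_le_card hU.redA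
    have h3 := vN_le_card hU.redB
    simp only [mi] at *
    linarith
  have h1 := ciInf_le hbdd 1
  have h2 := coh_redB_le h.dephA
  simp only [OneMemClass.coe_one, conjA_one, mi, redA_dephA, redB_dephA] at h1
  rw [redB_dephA, coh, coh, deph_dephA] at h2
  simp only [coh, mi, redA_dephA, redB_dephA] at *
  linarith

end Bipartite

section Marginals

variable {N : ℕ} {n : Fin N → Type*}

lemma glue_of_lt {i j : Fin N} (hj : (j : ℕ) < i)
    (h : ∀ j : {j : Fin N // (j : ℕ) < (i : ℕ)}, n j) (x : n i)
    (t : ∀ j : {j : Fin N // (i : ℕ) < (j : ℕ)}, n j) : glue i h x t j = h ⟨j, hj⟩ := by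
  simp [glue, hj]

lemma glue_of_gt {i j : Fin N} (hj : (i : ℕ) < j)
    (h : ∀ j : {j : Fin N // (j : ℕ) < (i : ℕ)}, n j) (x : n i)
    (t : ∀ j : {j : Fin N // (i : ℕ) < (j : ℕ)}, n j) : glue i h x t j = t ⟨j, hj⟩ := by
  simp [glue, hj, hj.le.not_gt]

@[simp]
lemma glue_self (i : Fin N) (h : ∀ j : {j : Fin N // (j : ℕ) < (i : ℕ)}, n j) (x : n i)
    (t : ∀ j : {j : Fin N // (i : ℕ) < (j : ℕ)}, n j) : glue i h x t i = x := by
  simp [glue]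

/-- Splitting a full index into its head, its component at `i`, and its tail. -/
def glueEquiv (n : Fin N → Type*) (i : Fin N) :
    ((∀ j : {j : Fin N // (j : ℕ) < (i : ℕ)}, n j) × n i ×
      ∀ j : {j : Fin N // (i : ℕ) < (j : ℕ)}, n j) ≃ ∀ j, n j where
  toFun p := glue i p.1 p.2.1 p.2.2
  invFun g := (fun j => g j, g i, fun j => g j)
  left_inv p := by
    refine Prod.ext (funext fun j => ?_) (Prod.ext ?_ (funext fun j => ?_))
    · exact glue_of_lt j.2 _ _ _
    · exact glue_self _ _ _ _
    · exact glue_of_gt j.2 _ _ _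
  right_inv g := by
    funext j
    rcases lt_trichotomy (j : ℕ) i with hj | hj | hj
    · exact glue_of_lt hj _ _ _
    · obtain rfl := Fin.ext hj
      exact glue_self _ _ _ _
    · exact glue_of_gt hj _ _ _

variable [∀ i, Fintype (n i)] [∀ i, DecidableEq (n i)]

/-- The reduced state on the subsystems satisfying `P`. -/
noncomputable def marginal (ρ : Matrix (∀ i, n i) (∀ i, n i) ℂ) (P : Fin N → Prop)
    [DecidablePred P] : Matrix (∀ j : {j // P j}, n j) (∀ j : {j // P j}, n j) ℂ :=
  Matrix.of fun t t' => ∑ h : ∀ j : {j // ¬ P j}, n j,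
    ρ ((Equiv.piEquivPiSubtypeProd P n).symm (t, h))
      ((Equiv.piEquivPiSubtypeProd P n).symm (t', h))

lemma coh_marginal_congr (ρ : Matrix (∀ i, n i) (∀ i, n i) ℂ) {P Q : Fin N → Prop}
    [DecidablePred P] [DecidablePred Q] (h : ∀ j, P j ↔ Q j) :
    coh (marginal ρ P) = coh (marginal ρ Q) := by
  obtain rfl : P = Q := funext fun j => propext (h j)
  congr!

lemma coh_marginal_of_forall (ρ : Matrix (∀ i, n i) (∀ i, n i) ℂ) {P : Fin N → Prop}
    [DecidablePred P] (h : ∀ j, P j) : coh (marginal ρ P) = coh ρ := by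
  have : IsEmpty {j // ¬ P j} := ⟨fun j => j.2 (h j)⟩
  let e : (∀ j : {j // P j}, n j) ≃ ∀ j, n j :=
    (Equiv.prodUnique _ _).symm.trans (Equiv.piEquivPiSubtypeProd P n).symm
  rw [← coh_submatrix_equiv ρ e]
  congr 1
  ext t t'
  rw [marginal, of_apply, Fintype.sum_unique]
  rfl

lemma coh_marginal_of_forall_not (ρ : Matrix (∀ i, n i) (∀ i, n i) ℂ) {P : Fin N → Prop}
    [DecidablePred P] (h : ∀ j, ¬ P j) : coh (marginal ρ P) = 0 := by
  have : IsEmpty {j // P j} := ⟨fun j => h j j.2⟩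
  exact coh_of_subsingleton _

lemma redB_redTail (ρ : Matrix (∀ i, n i) (∀ i, n i) ℂ) (i : Fin N) :
    redB (redTail ρ i) = marginal ρ fun j => (i : ℕ) < j := by
  ext t t'
  simp only [redB, redTail, marginal, of_apply]
  rw [Finset.sum_comm, ← Fintype.sum_prod_type']
  let e : ((∀ j : {j : Fin N // (j : ℕ) < (i : ℕ)}, n j) × n i) →
      ∀ j : {j : Fin N // ¬ (i : ℕ) < j}, n j := fun p j => glue i p.1 p.2 t j
  have he : ∀ p s, (Equiv.piEquivPiSubtypeProd (fun j : Fin N => (i : ℕ) < j) n).symm (s, e p)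
      = glue i p.1 p.2 s := by
    intro p s
    funext j
    rcases lt_trichotomy (j : ℕ) i with hj | hj | hj
    · simp [e, hj.le.not_gt, glue_of_lt hj]
    · obtain rfl := Fin.ext hj
      simp [e]
    · simp [hj, glue_of_gt hj]
  refine Fintype.sum_bijective e ⟨fun p p' h => ?_, fun k => ?_⟩ _ _ fun p => ?_
  · have := (glueEquiv n i).injective (a₁ := (p.1, p.2, t)) (a₂ := (p'.1, p'.2, t))
      ((he p t).symm.trans ((congrArg _ (congrArg _ h)).trans (he p' t)))
    simp only [Prod.mk.injEq] at this
    exact Prod.ext this.1 this.2.1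
  · let g := (Equiv.piEquivPiSubtypeProd (fun j : Fin N => (i : ℕ) < j) n).symm (t, k)
    refine ⟨(fun j => g j, g i), funext fun j => ?_⟩
    have h1 : ∀ j : Fin N, ∀ hj : ¬ (i : ℕ) < j, g j = k ⟨j, hj⟩ := fun j hj => by simp [g, hj]
    obtain ⟨j, hj⟩ := j
    rw [← h1 j hj]
    rcases (not_lt.mp hj).lt_or_eq with hj' | hj'
    · exact glue_of_lt hj' _ _ _
    · obtain rfl := Fin.ext hj'
      exact glue_self _ _ _ _
  · rw [he, he]

lemma redA_redTail (ρ : Matrix (∀ i, n i) (∀ i, n i) ℂ) (i : Fin N) :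
    redA (redTail ρ i) = red1 ρ i := by
  ext x x'
  simp only [redA, redTail, red1, of_apply]
  rw [← Fintype.sum_prod_type']
  let e : ((∀ j : {j : Fin N // (i : ℕ) < (j : ℕ)}, n j) ×
      ∀ j : {j : Fin N // (j : ℕ) < (i : ℕ)}, n j) →
      ∀ j : {j : Fin N // j ≠ i}, n j := fun p j => glue i p.2 x p.1 j
  have he : ∀ p y, (fun j => if h : j = i then h.symm ▸ y else e p ⟨j, h⟩) = glue i p.2 y p.1 := by
    intro p y
    funext j
    rcases lt_trichotomy (j : ℕ) i with hj | hj | hj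
    · have : j ≠ i := fun h => hj.ne (congrArg _ h)
      simp [e, this, glue_of_lt hj]
    · obtain rfl := Fin.ext hj
      simp
    · have : j ≠ i := fun h => hj.ne' (congrArg _ h)
      simp [e, this, glue_of_gt hj]
  refine Fintype.sum_bijective e ⟨fun p p' h => ?_, fun k => ?_⟩ _ _ fun p => ?_
  · have := (glueEquiv n i).injective (a₁ := (p.2, x, p.1)) (a₂ := (p'.2, x, p'.1))
      ((he p x).symm.trans ((congrArg (fun (k : ∀ j : {j : Fin N // j ≠ i}, n j) (j : Fin N) =>
        if h : j = i then h.symm ▸ x else k ⟨j, h⟩) h).trans (he p' x)))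
    simp only [Prod.mk.injEq] at this
    exact Prod.ext this.2.2 this.1
  · refine ⟨(fun j => k ⟨j, fun h => j.2.ne' (congrArg _ h)⟩,
      fun j => k ⟨j, fun h => j.2.ne (congrArg _ h)⟩), funext fun j => ?_⟩
    obtain ⟨j, hj⟩ := j
    rcases lt_or_gt_of_ne (fun h => hj (Fin.ext h) : (j : ℕ) ≠ i) with hj' | hj'
    · exact glue_of_lt hj' _ _ _
    · exact glue_of_gt hj' _ _ _
  · rw [he, he]

lemma coh_redTail (ρ : Matrix (∀ i, n i) (∀ i, n i) ℂ) (i : Fin N) :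
    coh (redTail ρ i) = coh (marginal ρ fun j => (i : ℕ) ≤ j) := by
  let P : Fin N → Prop := fun j => (i : ℕ) ≤ j
  let E := Equiv.piEquivPiSubtypeProd P n
  let e₁ : (∀ j : {j : Fin N // (j : ℕ) < (i : ℕ)}, n j) ≃ ∀ j : {j // ¬ P j}, n j :=
    { toFun := fun h j => h ⟨j, not_le.mp j.2⟩
      invFun := fun h j => h ⟨j, not_le.mpr j.2⟩ }
  let e₂ : (n i × ∀ j : {j : Fin N // (i : ℕ) < (j : ℕ)}, n j) ≃ ∀ j : {j // P j}, n j :=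
    { toFun := fun p j => if hj : (i : ℕ) < j then p.2 ⟨j, hj⟩
        else (Fin.ext (le_antisymm j.2 (not_lt.mp hj)) : i = j) ▸ p.1
      invFun := fun g => (g ⟨i, le_rfl⟩, fun j => g ⟨j, j.2.le⟩)
      left_inv := fun p => by
        refine Prod.ext ?_ (funext fun j => ?_)
        · simp
        · simp [j.2]
      right_inv := fun g => by
        funext ⟨j, hj⟩
        rcases lt_or_eq_of_le (show (i : ℕ) ≤ j from hj) with hj' | hj'
        · simp [hj']
        · obtain rfl := Fin.ext hj'
          simp }
  have he : ∀ h p, glue i h p.1 p.2 = E.symm (e₂ p, e₁ h) := by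
    intro h p
    funext j
    rcases lt_trichotomy (j : ℕ) i with hj | hj | hj
    · have : ¬ P j := not_le.mpr hj
      simp [E, e₁, this, glue_of_lt hj]
    · obtain rfl := Fin.ext hj
      have : P j := le_rfl
      simp [E, e₂, this]
    · have : P j := hj.le
      have hij : i < j := hj
      simp [E, e₂, this, hij, glue_of_gt hj]
  rw [← coh_submatrix_equiv (marginal ρ P) e₂]
  congr 1
  ext p q
  simp only [redTail, marginal, of_apply, submatrix_apply]
  refine Fintype.sum_equiv e₁ _ _ fun h => ?_
  rw [he, he]

lemma Matrix.PosSemidef.redTail {ρ : Matrix (∀ i, n i) (∀ i, n i) ℂ} (hρ : ρ.PosSemidef)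
    (i : Fin N) : (redTail ρ i).PosSemidef := by
  have : _root_.redTail ρ i = ∑ h, ρ.submatrix (fun p => glue i h p.1 p.2)
      (fun p => glue i h p.1 p.2) := by
    ext p q
    simp [_root_.redTail, Matrix.sum_apply]
  rw [this]
  exact posSemidef_sum _ fun h _ => hρ.submatrix _

lemma trace_redTail (ρ : Matrix (∀ i, n i) (∀ i, n i) ℂ) (i : Fin N) :
    (redTail ρ i).trace = ρ.trace := by
  simp only [Matrix.trace, diag_apply, redTail, of_apply]
  rw [Finset.sum_comm, ← Fintype.sum_prod_type']
  exact Fintype.sum_equiv (glueEquiv n i) _ _ fun p => rfl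

end Marginals

/-- Theorem 4 (first inequality):
`∑_{i=1}^{N−1} Θ^{i|i+1⋯N}(ρ^{i⋯N}) + ∑_{i=1}^{N} C(ρ^i) ≤ C(ρ)`, where the
first sum runs over all subsystems except the last one and
`Θ^{i|i+1⋯N}` is the one-sided (Zurek) discord of the reduced state on
subsystems `i, …, N` with measurement on subsystem `i`. -/
theorem sum_one_sided_discords_add_local_coherences_le_coherence
    {N : ℕ} {n : Fin N → Type*} [∀ i, Fintype (n i)] [∀ i, DecidableEq (n i)]
    [∀ i, Nonempty (n i)] (hN : 2 ≤ N)
    (ρ : Matrix (∀ i, n i) (∀ i, n i) ℂ) (hρ : ρ.PosSemidef) (htr : ρ.trace = 1) :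
    (∑ i ∈ Finset.univ.filter fun i : Fin N => (i : ℕ) + 1 < N,
        ⨅ U : Matrix.unitaryGroup (n i) ℂ,
          (mi (redTail ρ i)
            - mi (dephA (conjA (U : Matrix (n i) (n i) ℂ) (redTail ρ i)))))
      + ∑ i, coh (red1 ρ i) ≤ coh ρ := by

  set c : ℕ → ℝ := fun k => coh (marginal ρ fun j => k ≤ (j : ℕ))
  have hB : ∀ i : Fin N, coh (redB (redTail ρ i)) = c (i + 1) := fun i => by
    rw [redB_redTail]
    exact coh_marginal_congr ρ fun j => Nat.lt_iff_add_one_le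
  have hstep : ∀ i : Fin N, (if (i : ℕ) + 1 < N then
        ⨅ U : Matrix.unitaryGroup (n i) ℂ,
          (mi (redTail ρ i)
            - mi (dephA (conjA (U : Matrix (n i) (n i) ℂ) (redTail ρ i)))) else 0)
      + coh (red1 ρ i) ≤ c i - c (i + 1) := by
    intro i
    rw [← redA_redTail, ← hB, ← show coh (redTail ρ i) = c i from coh_redTail ρ i]
    split_ifs with hi
    · exact iInf_mi_sub_mi_add_coh_le (hρ.redTail i) ((trace_redTail ρ i).trans htr)
    · have : IsEmpty {j : Fin N // (i : ℕ) < j} := ⟨fun j => by omega⟩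
      rw [coh_redA_of_subsingleton, coh_of_subsingleton (redB _)]
      simp
  have hsum := Finset.sum_le_sum fun i (_ : i ∈ Finset.univ) => hstep i
  rw [Finset.sum_add_distrib, ← Finset.sum_filter,
    Fin.sum_univ_eq_sum_range (fun k => c k - c (k + 1)) N, Finset.sum_range_sub'] at hsum
  have h0 : c 0 = coh ρ := coh_marginal_of_forall ρ fun j => Nat.zero_le j
  have hN' : c N = 0 := coh_marginal_of_forall_not ρ fun j => not_le.mpr j.2
  rwa [h0, hN', sub_zero] at hsum
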